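/- Let μ be a probability measure on a complete separable metric space (X,d), let α be a Young function, and let c > 0. Then μ satisfies the transport-entropy inequality T_α(1/c) if and only if for every bounded continuous function f : X → ℝ it holds ∫ e^{c Q_α f} dμ ≤ e^{c ∫ f dμ}, where Q_α f(x) = inf_{y∈X} {f(y) + α(d(x,y))}. -/

import Mathlib

open MeasureTheory Filter Set Topology
open scoped ENNReal NNReal

noncomputable section

/-- The right derivative of a function `α : ℝ → ℝ`. -/
def rightD (α : ℝ → ℝ) (x : ℝ) : ℝ := derivWithin α (Set.Ioi x) x

/-- The left derivative of a function `α : ℝ → ℝ`. -/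
def leftD (α : ℝ → ℝ) (x : ℝ) : ℝ := derivWithin α (Set.Iio x) x

/-- A Young function: an even, convex, nonnegative function, increasing on `[0,∞)`,
vanishing at `0` and with vanishing right derivative at `0`. -/
structure IsYoung (α : ℝ → ℝ) : Prop where
  nonneg : ∀ x, 0 ≤ α x
  even : ∀ x, α (-x) = α x
  convex : ConvexOn ℝ Set.univ α
  mono : StrictMonoOn α (Set.Ici 0)
  zero : α 0 = 0
  rightD_zero : rightD α 0 = 0

/-- The Δ₂-condition for a Young function. -/
def DeltaTwo (α : ℝ → ℝ) : Prop := ∃ K > 0, ∀ x : ℝ, α (2 * x) ≤ K * α x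

/-- `r_α = inf_{x>0} x α'₋(x)/α(x)`. -/
def rAlpha (α : ℝ → ℝ) : ℝ := sInf {r : ℝ | ∃ x > 0, r = x * leftD α x / α x}

/-- `p_α = sup_{x>0} x α'₊(x)/α(x)`. -/
def pAlpha (α : ℝ → ℝ) : ℝ := sSup {r : ℝ | ∃ x > 0, r = x * rightD α x / α x}

/-- The Fenchel-Legendre transform `α*(y) = sup_x {xy - α(x)}`, with values in `[0,∞]`. -/
def legendre (α : ℝ → ℝ) (y : ℝ) : ℝ≥0∞ := ⨆ x : ℝ, ENNReal.ofReal (x * y - α x)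

/-- `ξ_α(t) = sup_{u>0} α*(t α'₊(u)) / (t α(u))`. -/
def xiAlpha (α : ℝ → ℝ) (t : ℝ) : ℝ≥0∞ :=
  ⨆ u : {u : ℝ // 0 < u}, legendre α (t * rightD α u) / ENNReal.ofReal (t * α u)

/-- A bounded real-valued function. -/
def IsBoundedFun {Y : Type*} (f : Y → ℝ) : Prop := ∃ M, ∀ x, |f x| ≤ M

variable {X : Type*} [MetricSpace X] [MeasurableSpace X]

/-- The optimal transport cost `T_α(ν,μ)` between two measures, for the cost
function `(x,y) ↦ α(d(x,y))`. -/
def transportCost (α : ℝ → ℝ) (ν μ : Measure X) : ℝ≥0∞ :=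
  sInf { c : ℝ≥0∞ | ∃ π : Measure (X × X), π.map Prod.fst = ν ∧ π.map Prod.snd = μ ∧
      c = ∫⁻ z, ENNReal.ofReal (α (dist z.1 z.2)) ∂π }

open Classical in
/-- The relative entropy `H(ν|μ) = ∫ log (dν/dμ) dν` if `ν ≪ μ` (and `+∞` if `ν` is not
absolutely continuous with respect to `μ`, or if the integral diverges). -/
def relEnt (ν μ : Measure X) : ℝ≥0∞ :=
  if ν ≪ μ ∧ Integrable (fun x => Real.log (ν.rnDeriv μ x).toReal) ν
  then ENNReal.ofReal (∫ x, Real.log (ν.rnDeriv μ x).toReal ∂ν) else ⊤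

/-- The transport-entropy inequality `T_α(C)`: for every probability measure `ν`,
`T_α(ν,μ) ≤ C H(ν|μ)`. -/
def TransportEntropy (μ : Measure X) (α : ℝ → ℝ) (C : ℝ) : Prop :=
  ∀ ν : Measure X, IsProbabilityMeasure ν →
    transportCost α ν μ ≤ ENNReal.ofReal C * relEnt ν μ

/-- The entropy functional `Ent_μ(e^f)`. -/
def entExp (μ : Measure X) (f : X → ℝ) : ℝ :=
  ∫ x, Real.exp (f x) * Real.log (Real.exp (f x)) ∂μ
    - (∫ x, Real.exp (f x) ∂μ) * Real.log (∫ x, Real.exp (f x) ∂μ)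

/-- `|∇⁺ f|(x) = limsup_{y → x} [f(y) - f(x)]₊ / d(y,x)` (equal to `0` at isolated
points by the conventions on `limsup` and `sInf` in `ℝ`). -/
def gradPlus (f : X → ℝ) (x : X) : ℝ :=
  limsup (fun y => max (f y - f x) 0 / dist y x) (𝓝[≠] x)

/-- `|∇⁻ f|(x) = limsup_{y → x} [f(y) - f(x)]₋ / d(y,x)` (equal to `0` at isolated
points by the conventions on `limsup` and `sInf` in `ℝ`). -/
def gradMinus (f : X → ℝ) (x : X) : ℝ :=
  limsup (fun y => max (-(f y - f x)) 0 / dist y x) (𝓝[≠] x)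

/-- The modified log-Sobolev inequality plus `LSI⁺_α(A)`. -/
def LSIplus (μ : Measure X) (α : ℝ → ℝ) (A : ℝ) : Prop :=
  ∀ f : X → ℝ, IsBoundedFun f → LocallyLipschitz f →
    ENNReal.ofReal (entExp μ f) ≤
      ENNReal.ofReal A * ∫⁻ x, legendre α (gradPlus f x) * ENNReal.ofReal (Real.exp (f x)) ∂μ

/-- The modified log-Sobolev inequality minus `LSI⁻_α(A)`. -/
def LSIminus (μ : Measure X) (α : ℝ → ℝ) (A : ℝ) : Prop :=
  ∀ f : X → ℝ, IsBoundedFun f → LocallyLipschitz f →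
    ENNReal.ofReal (entExp μ f) ≤
      ENNReal.ofReal A * ∫⁻ x, legendre α (gradMinus f x) * ENNReal.ofReal (Real.exp (f x)) ∂μ

/-- The inf-convolution operator `Q_α^λ f(x) = inf_y {f(y) + λ α(d(x,y))}`. -/
def QInf (α : ℝ → ℝ) (lam : ℝ) (f : X → ℝ) (x : X) : ℝ :=
  ⨅ y : X, (f y + lam * α (dist x y))

/-- The `(τ)`-log-Sobolev inequality `(τ)-LSI_α(λ, A)`. -/
def TauLSI (μ : Measure X) (α : ℝ → ℝ) (lam A : ℝ) : Prop :=
  ∀ f : X → ℝ, IsBoundedFun f → LocallyLipschitz f →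
    entExp μ f ≤ A * ∫ x, (f x - QInf α lam f x) * Real.exp (f x) ∂μ

/-- The `n`-dimensional inf-convolution operator
`Q_{α,n} f(x) = inf_y {f(y) + Σᵢ α(d(xᵢ,yᵢ))}`. -/
def QInfN (α : ℝ → ℝ) {n : ℕ} (f : (Fin n → X) → ℝ) (x : Fin n → X) : ℝ :=
  ⨅ y : Fin n → X, (f y + ∑ i, α (dist (x i) (y i)))

/-- The `n`-dimensional sup-convolution operator
`P_{α,n} f(x) = sup_y {f(y) - Σᵢ α(d(xᵢ,yᵢ))}`. -/
def PSupN (α : ℝ → ℝ) {n : ℕ} (f : (Fin n → X) → ℝ) (x : Fin n → X) : ℝ :=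
  ⨆ y : Fin n → X, (f y - ∑ i, α (dist (x i) (y i)))

end

/-- Duality for the finite transportation problem: if the dual value is at most `K`, then some
coupling matrix has cost at most `K`. -/
lemma exists_matrix_coupling {ι κ : Type*} [Fintype ι] [Fintype κ] (p : ι → ℝ) (q : κ → ℝ)
    (hp : ∀ i, 0 ≤ p i) (hq : ∀ j, 0 ≤ q j) (hp1 : ∑ i, p i = 1) (hq1 : ∑ j, q j = 1)
    (C : ι → κ → ℝ) (K : ℝ)
    (h : ∀ (u : ι → ℝ) (v : κ → ℝ), (∀ i j, u i - v j ≤ C i j) →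
      ∑ i, p i * u i - ∑ j, q j * v j ≤ K) :
    ∃ P : ι → κ → ℝ, (∀ i j, 0 ≤ P i j) ∧ (∀ i, ∑ j, P i j = p i) ∧ (∀ j, ∑ i, P i j = q j) ∧
      ∑ i, ∑ j, P i j * C i j ≤ K := by
  classical
  by_contra hcon
  let A : (ι × κ → ℝ) →ₗ[ℝ] (ι → ℝ) × (κ → ℝ) × ℝ :=
    { toFun := fun P => (fun i => ∑ j, P (i, j), fun j => ∑ i, P (i, j),
        ∑ i, ∑ j, P (i, j) * C i j)
      map_add' := by
        intro P Q
        ext <;> simp [Finset.sum_add_distrib, add_mul]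
      map_smul' := by
        intro r P
        ext <;> simp [Finset.mul_sum, mul_assoc] }
  let T : Set ((ι → ℝ) × (κ → ℝ) × ℝ) := {p} ×ˢ ({q} ×ˢ Iic K)
  have hTconv : Convex ℝ T :=
    (convex_singleton p).prod ((convex_singleton q).prod (convex_Iic K))
  have hTclosed : IsClosed T := isClosed_singleton.prod (isClosed_singleton.prod isClosed_Iic)
  have hScomp : IsCompact (A '' stdSimplex ℝ (ι × κ)) :=
    (isCompact_stdSimplex ℝ (ι × κ)).image A.continuous_of_finiteDimensional
  have hSconv : Convex ℝ (A '' stdSimplex ℝ (ι × κ)) := (convex_stdSimplex ℝ _).linear_image A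
  have hdisj : Disjoint (A '' stdSimplex ℝ (ι × κ)) T := by
    rw [Set.disjoint_left]
    rintro _ ⟨P, hP, rfl⟩ ⟨h1, h2, h3⟩
    exact hcon ⟨fun i j => P (i, j), fun i j => hP.1 _, fun i => congrFun h1 i,
      fun j => congrFun h2 j, h3⟩
  obtain ⟨F, lo, hi, hlo, hlt, hhi⟩ :=
    geometric_hahn_banach_compact_closed hSconv hScomp hTconv hTclosed hdisj
  set a : ι → ℝ := fun i => F (Pi.single i 1, 0, 0) with ha
  set b : κ → ℝ := fun j => F (0, Pi.single j 1, 0) with hb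
  set t : ℝ := F (0, 0, 1) with ht
  have hF : ∀ (x : ι → ℝ) (y : κ → ℝ) (z : ℝ),
      F (x, y, z) = ∑ i, x i * a i + ∑ j, y j * b j + z * t := by
    intro x y z
    have hx : x = ∑ i, x i • (Pi.single i (1 : ℝ) : ι → ℝ) := by
      ext k; simp [Finset.sum_apply, Pi.single_apply]
    have hy : y = ∑ j, y j • (Pi.single j (1 : ℝ) : κ → ℝ) := by
      ext k; simp [Finset.sum_apply, Pi.single_apply]
    have e1 : F (x, 0, 0) = ∑ i, x i * a i := by
      have := map_sum (F.toLinearMap ∘ₗ LinearMap.inl ℝ (ι → ℝ) ((κ → ℝ) × ℝ))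
        (fun i => x i • (Pi.single i (1 : ℝ) : ι → ℝ)) Finset.univ
      rw [← hx] at this
      simp only [map_smul, smul_eq_mul] at this
      exact this
    have e2 : F (0, y, 0) = ∑ j, y j * b j := by
      have := map_sum (F.toLinearMap ∘ₗ LinearMap.inr ℝ (ι → ℝ) ((κ → ℝ) × ℝ) ∘ₗ
        LinearMap.inl ℝ (κ → ℝ) ℝ) (fun j => y j • (Pi.single j (1 : ℝ) : κ → ℝ)) Finset.univ
      rw [← hy] at this
      simp only [map_smul, smul_eq_mul] at this
      exact this
    have e3 : F (0, 0, z) = z * t := by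
      have := F.map_smul z (0, 0, 1)
      simpa using this
    rw [← e1, ← e2, ← e3, ← map_add, ← map_add]
    simp
  have hdelta : ∀ i j, a i + b j + C i j * t < lo := by
    intro i j
    have h1 := hlo (A (Pi.single (i, j) 1)) ⟨_, single_mem_stdSimplex ℝ (i, j), rfl⟩
    have hsingle : ∀ k l, (Pi.single (i, j) (1 : ℝ) : ι × κ → ℝ) (k, l) =
        if k = i then (if l = j then 1 else 0) else 0 := by
      intro k l
      by_cases hk : k = i <;> by_cases hl : l = j <;> simp [hk, hl]
    have h2 : A (Pi.single (i, j) 1) =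
        (fun k => ∑ l, if k = i then (if l = j then (1 : ℝ) else 0) else 0,
         fun l => ∑ k, if k = i then (if l = j then (1 : ℝ) else 0) else 0,
         ∑ k, ∑ l, (if k = i then (if l = j then (1 : ℝ) else 0) else 0) * C k l) := by
      simp only [← hsingle]; rfl
    rw [h2, hF] at h1
    simpa [Finset.sum_ite_irrel] using h1
  have hT : ∀ k ≤ K, hi < ∑ i, p i * a i + ∑ j, q j * b j + k * t := by
    intro k hk
    rw [← hF]
    exact hhi _ ⟨rfl, rfl, hk⟩
  set m : ℝ := ∑ i, p i * a i + ∑ j, q j * b j with hm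
  have ht0 : t ≤ 0 := by
    by_contra! htpos
    have h1 := hT (min K ((hi - m) / t)) (min_le_left _ _)
    have h2 : min K ((hi - m) / t) * t ≤ (hi - m) / t * t :=
      mul_le_mul_of_nonneg_right (min_le_right _ _) htpos.le
    rw [div_mul_cancel₀ _ htpos.ne'] at h2
    linarith
  have hK := hT K le_rfl
  rcases ht0.lt_or_eq with htneg | htz
  · have h1 := h (fun i => a i / (-t)) (fun j => (lo - b j) / (-t)) (by
      intro i j
      rw [← sub_div, div_le_iff₀ (by linarith)]
      linarith [hdelta i j])
    have h2 : ∑ i, p i * (a i / (-t)) - ∑ j, q j * ((lo - b j) / (-t)) = (m - lo) / (-t) := by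
      simp only [← mul_div_assoc, ← Finset.sum_div, mul_sub, Finset.sum_sub_distrib,
        ← Finset.sum_mul, hq1, hm]
      ring
    rw [h2, div_le_iff₀ (by linarith)] at h1
    linarith
  · have h1 : m = ∑ i, ∑ j, p i * q j * (a i + b j) := by
      have e1 : ∀ i, ∑ j, p i * q j * (a i + b j) = p i * a i + p i * ∑ j, q j * b j := by
        intro i
        have : p i * a i = p i * a i * ∑ j, q j := by rw [hq1, mul_one]
        rw [this, Finset.mul_sum, Finset.mul_sum, ← Finset.sum_add_distrib]
        exact Finset.sum_congr rfl fun j _ => by ring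
      simp only [e1, Finset.sum_add_distrib, ← Finset.sum_mul, hp1, one_mul, hm]
    have h2 : ∑ i, ∑ j, p i * q j * (a i + b j) ≤ ∑ i, ∑ j, p i * q j * lo := by
      refine Finset.sum_le_sum fun i _ => Finset.sum_le_sum fun j _ => ?_
      refine mul_le_mul_of_nonneg_left ?_ (mul_nonneg (hp i) (hq j))
      have := hdelta i j
      rw [htz] at this
      linarith
    have h3 : ∑ i, ∑ j, p i * q j * lo = lo := by
      simp only [← Finset.sum_mul, ← Finset.mul_sum, hq1, hp1, mul_one, one_mul]
    rw [htz] at hK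
    linarith

lemma sum_smul_cond_fiber {Y ι : Type*} [MeasurableSpace Y] [Fintype ι] [MeasurableSpace ι]
    [MeasurableSingletonClass ι] (ν : Measure Y) [IsFiniteMeasure ν] {s : Y → ι}
    (hs : Measurable s) :
    ∑ i, ν (s ⁻¹' {i}) • ProbabilityTheory.cond ν (s ⁻¹' {i}) = ν := by
  ext A hA
  simp only [Measure.finsetSum_apply, Measure.smul_apply, smul_eq_mul]
  have h1 : ∀ i, ν (s ⁻¹' {i}) * ProbabilityTheory.cond ν (s ⁻¹' {i}) A =
      ν (A ∩ s ⁻¹' {i}) := by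
    intro i
    rw [mul_comm, ProbabilityTheory.cond_mul_eq_inter (hs (measurableSet_singleton i)), inter_comm]
  simp only [h1]
  have := (measure_biUnion_finset (μ := ν) (s := Finset.univ) (f := fun i => A ∩ s ⁻¹' {i})
    (fun i _ j _ hij => Disjoint.mono inter_subset_right inter_subset_right
      (Disjoint.preimage s (by simpa using hij)))
    (fun i _ => hA.inter (hs (measurableSet_singleton i)))).symm
  rw [this]
  congr 1
  ext x; simp

/-- A coupling matrix of the laws of a finite-valued map `s` lifts to a coupling of the measures. -/
lemma exists_coupling_of_matrix {Y ι : Type*} [MeasurableSpace Y] [Fintype ι] [MeasurableSpace ι]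
    [MeasurableSingletonClass ι] (ν μ : Measure Y) [IsProbabilityMeasure ν]
    [IsProbabilityMeasure μ] {s : Y → ι} (hs : Measurable s) (P : ι → ι → ℝ)
    (hP : ∀ i j, 0 ≤ P i j) (hrow : ∀ i, ∑ j, P i j = ν.real (s ⁻¹' {i}))
    (hcol : ∀ j, ∑ i, P i j = μ.real (s ⁻¹' {j})) :
    ∃ π : Measure (Y × Y), π.map Prod.fst = ν ∧ π.map Prod.snd = μ ∧
      ∀ i j, π ((s ⁻¹' {i}) ×ˢ (s ⁻¹' {j})) = ENNReal.ofReal (P i j) := by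
  classical
  have hνz : ∀ i j, P i j ≠ 0 → ν (s ⁻¹' {i}) ≠ 0 := by
    intro i j hne h0
    have h1 : ν.real (s ⁻¹' {i}) = 0 := by simp [Measure.real, h0]
    rw [← hrow i, Finset.sum_eq_zero_iff_of_nonneg fun j _ => hP i j] at h1
    exact hne (h1 j (Finset.mem_univ j))
  have hμz : ∀ i j, P i j ≠ 0 → μ (s ⁻¹' {j}) ≠ 0 := by
    intro i j hne h0
    have h1 : μ.real (s ⁻¹' {j}) = 0 := by simp [Measure.real, h0]
    rw [← hcol j, Finset.sum_eq_zero_iff_of_nonneg fun i _ => hP i j] at h1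
    exact hne (h1 i (Finset.mem_univ i))
  let νc : ι → Measure Y := fun i => ProbabilityTheory.cond ν (s ⁻¹' {i})
  let μc : ι → Measure Y := fun j => ProbabilityTheory.cond μ (s ⁻¹' {j})
  have hνu : ∀ i j, P i j ≠ 0 → νc i univ = 1 := by
    intro i j hne
    have := ProbabilityTheory.cond_isProbabilityMeasure (hνz i j hne)
    exact measure_univ
  have hμu : ∀ i j, P i j ≠ 0 → μc j univ = 1 := by
    intro i j hne
    have := ProbabilityTheory.cond_isProbabilityMeasure (hμz i j hne)
    exact measure_univ
  refine ⟨∑ i, ∑ j, ENNReal.ofReal (P i j) • (νc i).prod (μc j), ?_, ?_, ?_⟩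
  · have h1 : ∀ i j, ENNReal.ofReal (P i j) • ((νc i).prod (μc j)).map Prod.fst =
        ENNReal.ofReal (P i j) • νc i := by
      intro i j
      rcases eq_or_ne (P i j) 0 with h0 | h0
      · simp [h0]
      · rw [Measure.map_fst_prod, hμu i j h0, one_smul]
    simp only [Measure.map_finset_sum' measurable_fst.aemeasurable, Measure.map_smul, h1,
      ← Finset.sum_smul]
    conv_rhs => rw [← sum_smul_cond_fiber ν hs]
    refine Finset.sum_congr rfl fun i _ => ?_
    rw [← ENNReal.ofReal_sum_of_nonneg fun j _ => hP i j, hrow, ofReal_measureReal]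
  · have h1 : ∀ i j, ENNReal.ofReal (P i j) • ((νc i).prod (μc j)).map Prod.snd =
        ENNReal.ofReal (P i j) • μc j := by
      intro i j
      rcases eq_or_ne (P i j) 0 with h0 | h0
      · simp [h0]
      · rw [Measure.map_snd_prod, hνu i j h0, one_smul]
    simp only [Measure.map_finset_sum' measurable_snd.aemeasurable, Measure.map_smul, h1]
    rw [Finset.sum_comm]
    simp only [← Finset.sum_smul]
    conv_rhs => rw [← sum_smul_cond_fiber μ hs]
    refine Finset.sum_congr rfl fun j _ => ?_
    rw [← ENNReal.ofReal_sum_of_nonneg fun i _ => hP i j, hcol, ofReal_measureReal]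
  · intro i j
    have hcond : ∀ (ρ : Measure Y) (k l : ι), k ≠ l →
        ProbabilityTheory.cond ρ (s ⁻¹' {k}) (s ⁻¹' {l}) = 0 := by
      intro ρ k l hkl
      rw [ProbabilityTheory.cond_apply (hs (measurableSet_singleton k)), ← preimage_inter]
      simp [hkl]
    simp only [Measure.finsetSum_apply, Measure.smul_apply, smul_eq_mul, Measure.prod_prod]
    rw [Finset.sum_eq_single i, Finset.sum_eq_single j]
    · rcases eq_or_ne (P i j) 0 with h0 | h0
      · simp [h0]
      · rw [ProbabilityTheory.cond_apply_self (hνz i j h0) (measure_ne_top _ _),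
          ProbabilityTheory.cond_apply_self (hμz i j h0) (measure_ne_top _ _)]
        simp
    · intro l _ hl
      rw [hcond μ l j hl]; simp
    · simp
    · intro k _ hk
      refine Finset.sum_eq_zero fun l _ => ?_
      rw [hcond ν k i hk]; simp
    · simp

lemma continuous_of_le_add_min_dist {X : Type*} [MetricSpace X] {h : X → ℝ} {L M : ℝ}
    (hh : ∀ x x', h x ≤ h x' + min (L * dist x x') M) : Continuous h := by
  refine (LipschitzWith.of_le_add_mul' L fun x y => ?_).continuous
  exact (hh x y).trans (by gcongr; exact min_le_left _ _)

lemma isBoundedFun_of_le_add_min_dist {X : Type*} [MetricSpace X] [Nonempty X] {h : X → ℝ}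
    {L M : ℝ} (hh : ∀ x x', h x ≤ h x' + min (L * dist x x') M) : IsBoundedFun h := by
  obtain ⟨x₀⟩ := ‹Nonempty X›
  refine ⟨|h x₀| + M, fun x => abs_le.2 ⟨?_, ?_⟩⟩
  · linarith [hh x₀ x, min_le_right (L * dist x₀ x) M, neg_abs_le (h x₀)]
  · linarith [hh x x₀, min_le_right (L * dist x x₀) M, le_abs_self (h x₀)]

lemma IsBoundedFun.integrable {Y : Type*} [MeasurableSpace Y] {f : Y → ℝ} (hb : IsBoundedFun f)
    (hf : Measurable f) (ρ : Measure Y) [IsFiniteMeasure ρ] : Integrable f ρ := by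
  obtain ⟨M, hM⟩ := hb
  exact Integrable.of_bound hf.aestronglyMeasurable M (ae_of_all _ hM)

/-- Approximate Kantorovich duality for a bounded Lipschitz cost, with error controlled by a finite
quantization `x ↦ a (s x)` of the space. -/
lemma exists_coupling_of_quantization {X ι : Type*} [MetricSpace X]
    [TopologicalSpace.SeparableSpace X] [MeasurableSpace X] [BorelSpace X]
    [Fintype ι] [MeasurableSpace ι] [MeasurableSingletonClass ι]
    (ν μ : Measure X) [IsProbabilityMeasure ν] [IsProbabilityMeasure μ]
    {c : X → X → ℝ} {L M : ℝ} (hL : 0 ≤ L) (hM : 0 ≤ M) (hc0 : ∀ x y, 0 ≤ c x y)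
    (hc : ∀ x x' y y', c x y ≤ c x' y' + min (L * dist x x') M + min (L * dist y y') M)
    {K : ℝ} (hK : ∀ f g : X → ℝ, Continuous f → IsBoundedFun f → Continuous g → IsBoundedFun g →
      (∀ x y, g x - f y ≤ c x y) → ∫ x, g x ∂ν - ∫ y, f y ∂μ ≤ K)
    {s : X → ι} (hs : Measurable s) (a : ι → X) :
    ∃ π : Measure (X × X), π.map Prod.fst = ν ∧ π.map Prod.snd = μ ∧
      ∫⁻ z, ENNReal.ofReal (c z.1 z.2) ∂π ≤
        ENNReal.ofReal (K + 2 * ∫ x, min (L * dist x (a (s x))) M ∂ν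
          + 2 * ∫ x, min (L * dist x (a (s x))) M ∂μ) := by
  classical
  obtain ⟨x₀⟩ : Nonempty X := nonempty_of_isProbabilityMeasure ν
  have : Nonempty X := ⟨x₀⟩
  have : Nonempty ι := ⟨s x₀⟩
  have hself : ∀ x : X, min (L * dist x x) M = 0 := by intro x; simp [hM]
  have hm0 : ∀ x y : X, 0 ≤ min (L * dist x y) M := fun x y => le_min (by positivity) hM
  set e : X → ℝ := fun x => min (L * dist x (a (s x))) M with he
  have he0 : ∀ x, 0 ≤ e x := fun x => hm0 _ _
  have hsa : Measurable fun x => a (s x) := (measurable_from_top (f := a)).comp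
    (hs.mono le_rfl (by exact fun t _ => (Set.toFinite t).measurableSet))
  have heM : Measurable e := by
    exact ((measurable_id.dist hsa).const_mul L).min measurable_const
  have heb : IsBoundedFun e := ⟨M, fun x => by rw [abs_of_nonneg (he0 x)]; exact min_le_right _ _⟩
  have hlaw : ∀ (ρ : Measure X) [IsProbabilityMeasure ρ] (u : ι → ℝ),
      Integrable (fun x => u (s x)) ρ ∧
      ∫ x, u (s x) ∂ρ = ∑ i, ρ.real (s ⁻¹' {i}) * u i := by
    intro ρ _ u
    have hfm : IsProbabilityMeasure (ρ.map s) := Measure.isProbabilityMeasure_map hs.aemeasurable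
    have hint : Integrable u (ρ.map s) := .of_finite
    refine ⟨hint.comp_measurable hs, ?_⟩
    rw [← integral_map hs.aemeasurable hint.aestronglyMeasurable, integral_fintype hint]
    refine Finset.sum_congr rfl fun i _ => ?_
    rw [map_measureReal_apply hs (measurableSet_singleton i), smul_eq_mul]
  have hsum : ∀ (ρ : Measure X) [IsProbabilityMeasure ρ], ∑ i, ρ.real (s ⁻¹' {i}) = 1 := by
    intro ρ _
    have := (hlaw ρ fun _ => 1).2
    simpa using this.symm
  obtain ⟨P, hP0, hrow, hcol, hcost⟩ := exists_matrix_coupling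
    (fun i => ν.real (s ⁻¹' {i})) (fun i => μ.real (s ⁻¹' {i}))
    (fun i => measureReal_nonneg) (fun i => measureReal_nonneg) (hsum ν) (hsum μ)
    (fun i j => c (a i) (a j)) (K + ∫ x, e x ∂ν + ∫ x, e x ∂μ) (by
      intro u v huv
      set f : X → ℝ := fun y => ⨆ i, (u i - c (a i) y) with hf
      have hfle : ∀ i y, u i - c (a i) y ≤ f y := fun i y =>
        le_ciSup (f := fun i => u i - c (a i) y) (Set.finite_range _).bddAbove i
      have hfmod : ∀ y y', f y ≤ f y' + min (L * dist y y') M := by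
        intro y y'
        refine ciSup_le fun i => ?_
        have h1 := hc (a i) (a i) y' y
        rw [hself, dist_comm] at h1
        linarith [hfle i y']
      have hfb := isBoundedFun_of_le_add_min_dist hfmod
      have hfc := continuous_of_le_add_min_dist hfmod
      set g : X → ℝ := fun x => ⨅ y, (f y + c x y) with hg
      have hgle : ∀ x y, g x ≤ f y + c x y := by
        intro x y
        obtain ⟨B, hB⟩ := hfb
        refine ciInf_le (f := fun y => f y + c x y) ⟨-B, ?_⟩ y
        rintro _ ⟨z, rfl⟩
        have := (abs_le.1 (hB z)).1
        have := hc0 x z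
        simp only
        linarith
      have hgmod : ∀ x x', g x ≤ g x' + min (L * dist x x') M := by
        intro x x'
        rw [← sub_le_iff_le_add]
        refine le_ciInf fun y => ?_
        have h1 := hc x x' y y
        rw [hself] at h1
        linarith [hgle x y]
      have hgb := isBoundedFun_of_le_add_min_dist hgmod
      have hgc := continuous_of_le_add_min_dist hgmod
      have hdual := hK f g hfc hfb hgc hgb fun x y => by linarith [hgle x y]
      have hug : ∀ i, u i ≤ g (a i) := fun i => le_ciInf fun y => by linarith [hfle i y]
      have hfv : ∀ j, f (a j) ≤ v j := fun j => ciSup_le fun i => by linarith [huv i j]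
      have hgi := hgb.integrable hgc.measurable ν
      have hfi := hfb.integrable hfc.measurable μ
      have h1 : ∫ x, u (s x) ∂ν ≤ ∫ x, (g x + e x) ∂ν := by
        refine integral_mono (hlaw ν u).1 (hgi.add (heb.integrable heM ν)) fun x => ?_
        have := hgmod (a (s x)) x
        rw [dist_comm] at this
        exact (hug (s x)).trans this
      have h2 : ∫ x, f x ∂μ ≤ ∫ x, (v (s x) + e x) ∂μ := by
        refine integral_mono hfi ((hlaw μ v).1.add (heb.integrable heM μ)) fun x => ?_
        exact (hfmod x (a (s x))).trans (by gcongr; exact hfv _)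
      rw [integral_add hgi (heb.integrable heM ν), (hlaw ν u).2] at h1
      rw [integral_add (hlaw μ v).1 (heb.integrable heM μ), (hlaw μ v).2] at h2
      linarith)
  obtain ⟨π, h1, h2, h3⟩ := exists_coupling_of_matrix ν μ hs P hP0 hrow hcol
  refine ⟨π, h1, h2, ?_⟩
  have hcell : ∫⁻ z, ENNReal.ofReal (c (a (s z.1)) (a (s z.2))) ∂π =
      ENNReal.ofReal (∑ i, ∑ j, P i j * c (a i) (a j)) := by
    have hss : Measurable (Prod.map s s) := hs.prodMap hs
    have hmeas : Measurable fun k : ι × ι => ENNReal.ofReal (c (a k.1) (a k.2)) :=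
      fun t _ => (Set.toFinite _).measurableSet
    calc ∫⁻ z, ENNReal.ofReal (c (a (s z.1)) (a (s z.2))) ∂π
        = ∫⁻ k, ENNReal.ofReal (c (a k.1) (a k.2)) ∂(π.map (Prod.map s s)) := by
          rw [lintegral_map hmeas hss]; rfl
      _ = ∑ k : ι × ι, ENNReal.ofReal (P k.1 k.2 * c (a k.1) (a k.2)) := by
          rw [lintegral_fintype]
          refine Finset.sum_congr rfl fun k _ => ?_
          rw [Measure.map_apply hss (measurableSet_singleton k),
            ENNReal.ofReal_mul (hP0 _ _), ← h3, mul_comm]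
          congr 2
          ext z
          simp [Prod.ext_iff]
      _ = _ := by
          rw [← ENNReal.ofReal_sum_of_nonneg fun k _ => mul_nonneg (hP0 _ _) (hc0 _ _),
            Fintype.sum_prod_type]
  have hfst : ∫⁻ z, ENNReal.ofReal (e z.1) ∂π = ENNReal.ofReal (∫ x, e x ∂ν) := by
    rw [ofReal_integral_eq_lintegral_ofReal (heb.integrable heM ν) (ae_of_all _ he0), ← h1,
      lintegral_map heM.ennreal_ofReal measurable_fst]
  have hsnd : ∫⁻ z, ENNReal.ofReal (e z.2) ∂π = ENNReal.ofReal (∫ x, e x ∂μ) := by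
    rw [ofReal_integral_eq_lintegral_ofReal (heb.integrable heM μ) (ae_of_all _ he0), ← h2,
      lintegral_map heM.ennreal_ofReal measurable_snd]
  have heν : 0 ≤ ∫ x, e x ∂ν := integral_nonneg he0
  have heμ : 0 ≤ ∫ x, e x ∂μ := integral_nonneg he0
  calc ∫⁻ z, ENNReal.ofReal (c z.1 z.2) ∂π
      ≤ ∫⁻ z, (ENNReal.ofReal (c (a (s z.1)) (a (s z.2))) + ENNReal.ofReal (e z.1)
          + ENNReal.ofReal (e z.2)) ∂π := by
        refine lintegral_mono fun z => ?_
        rw [← ENNReal.ofReal_add (hc0 _ _) (he0 _),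
          ← ENNReal.ofReal_add (add_nonneg (hc0 _ _) (he0 _)) (he0 _)]
        exact ENNReal.ofReal_le_ofReal (hc _ _ _ _)
    _ = ENNReal.ofReal (∑ i, ∑ j, P i j * c (a i) (a j)) + ENNReal.ofReal (∫ x, e x ∂ν)
          + ENNReal.ofReal (∫ x, e x ∂μ) := by
        rw [lintegral_add_right _ (by fun_prop : Measurable fun z : X × X => ENNReal.ofReal (e z.2)),
          lintegral_add_right _ (by fun_prop : Measurable fun z : X × X => ENNReal.ofReal (e z.1)),
          hcell, hfst, hsnd]
    _ ≤ _ := by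
        have hsum0 : 0 ≤ ∑ i, ∑ j, P i j * c (a i) (a j) :=
          Finset.sum_nonneg fun i _ => Finset.sum_nonneg fun j _ =>
            mul_nonneg (hP0 _ _) (hc0 _ _)
        rw [← ENNReal.ofReal_add hsum0 heν, ← ENNReal.ofReal_add (add_nonneg hsum0 heν) heμ]
        refine ENNReal.ofReal_le_ofReal ?_
        linarith

/-- Kantorovich duality for a bounded Lipschitz cost, up to an arbitrarily small error. -/
lemma exists_coupling_lintegral_le_of_lipschitz {X : Type*} [MetricSpace X]
    [TopologicalSpace.SeparableSpace X] [MeasurableSpace X] [BorelSpace X]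
    (ν μ : Measure X) [IsProbabilityMeasure ν] [IsProbabilityMeasure μ]
    {c : X → X → ℝ} {L M : ℝ} (hL : 0 ≤ L) (hM : 0 ≤ M) (hc0 : ∀ x y, 0 ≤ c x y)
    (hc : ∀ x x' y y', c x y ≤ c x' y' + min (L * dist x x') M + min (L * dist y y') M)
    {K : ℝ} (hK : ∀ f g : X → ℝ, Continuous f → IsBoundedFun f → Continuous g → IsBoundedFun g →
      (∀ x y, g x - f y ≤ c x y) → ∫ x, g x ∂ν - ∫ y, f y ∂μ ≤ K)
    {ε : ℝ} (hε : 0 < ε) :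
    ∃ π : Measure (X × X), π.map Prod.fst = ν ∧ π.map Prod.snd = μ ∧
      ∫⁻ z, ENNReal.ofReal (c z.1 z.2) ∂π ≤ ENNReal.ofReal (K + ε) := by
  have : Nonempty X := nonempty_of_isProbabilityMeasure ν
  let d : ℕ → X := TopologicalSpace.denseSeq X
  have hlim : ∀ (ρ : Measure X) [IsProbabilityMeasure ρ],
      Tendsto (fun N => ∫ x, min (L * dist x (SimpleFunc.nearestPt d N x)) M ∂ρ) atTop (𝓝 0) := by
    intro ρ _
    have h0 : ∫ _ : X, (0 : ℝ) ∂ρ = 0 := integral_zero _ _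
    rw [← h0]
    refine tendsto_integral_of_dominated_convergence (fun _ => M) (fun N => ?_)
      (integrable_const M) (fun N => ae_of_all _ fun x => ?_) (ae_of_all _ fun x => ?_)
    · exact (((measurable_id.dist (SimpleFunc.nearestPt d N).measurable).const_mul L).min
        measurable_const).aestronglyMeasurable
    · rw [Real.norm_of_nonneg (le_min (by positivity) hM)]
      exact min_le_right _ _
    · have h1 : Tendsto (fun N => SimpleFunc.nearestPt d N x) atTop (𝓝 x) :=
        SimpleFunc.tendsto_nearestPt (TopologicalSpace.denseRange_denseSeq X x)
      have h2 := ((tendsto_const_nhds (x := x)).dist h1).const_mul L |>.min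
        (tendsto_const_nhds (x := M))
      simpa [hM] using h2
  have hsmall : ∀ᶠ N in atTop, 2 * ∫ x, min (L * dist x (SimpleFunc.nearestPt d N x)) M ∂ν
      + 2 * ∫ x, min (L * dist x (SimpleFunc.nearestPt d N x)) M ∂μ < ε := by
    have := ((hlim ν).const_mul 2).add ((hlim μ).const_mul 2)
    exact this.eventually_lt_const (by simpa using hε)
  obtain ⟨N, hN⟩ := hsmall.exists
  let s : X → Fin (N + 1) := fun x =>
    ⟨SimpleFunc.nearestPtInd d N x, Nat.lt_succ_of_le (SimpleFunc.nearestPtInd_le d N x)⟩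
  have hs : Measurable s := by
    refine measurable_to_countable' fun i => ?_
    have : s ⁻¹' {i} = SimpleFunc.nearestPtInd d N ⁻¹' {(i : ℕ)} := by
      ext x; simp [s, Fin.ext_iff]
    rw [this]
    exact (SimpleFunc.nearestPtInd d N).measurable (measurableSet_singleton _)
  obtain ⟨π, h1, h2, h3⟩ := exists_coupling_of_quantization ν μ hL hM hc0 hc hK hs (fun i => d i)
  refine ⟨π, h1, h2, h3.trans (ENNReal.ofReal_le_ofReal ?_)⟩
  have : ∀ x, d (s x) = SimpleFunc.nearestPt d N x := fun x => rfl
  simp only [this]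
  linarith

lemma isProbabilityMeasure_of_map_fst {X Y : Type*} [MeasurableSpace X] [MeasurableSpace Y]
    {π : Measure (X × Y)} {ν : Measure X} [IsProbabilityMeasure ν] (h : π.map Prod.fst = ν) :
    IsProbabilityMeasure π :=
  ⟨by rw [← measure_univ (μ := ν), ← h, Measure.map_apply measurable_fst .univ, preimage_univ]⟩

/-- Sequences of couplings of two probability measures on a Polish space have a subnet converging
weakly to a coupling. -/
lemma exists_coupling_tendsto {X : Type*} [MetricSpace X] [CompleteSpace X]
    [TopologicalSpace.SeparableSpace X] [MeasurableSpace X] [BorelSpace X]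
    (ν μ : Measure X) [IsProbabilityMeasure ν] [IsProbabilityMeasure μ]
    (π : ℕ → ProbabilityMeasure (X × X)) (h1 : ∀ n, (π n : Measure (X × X)).map Prod.fst = ν)
    (h2 : ∀ n, (π n : Measure (X × X)).map Prod.snd = μ) :
    ∃ π₀ : ProbabilityMeasure (X × X), (π₀ : Measure (X × X)).map Prod.fst = ν ∧
      (π₀ : Measure (X × X)).map Prod.snd = μ ∧ Tendsto π (hyperfilter ℕ) (𝓝 π₀) := by
  have := UniformSpace.secondCountable_of_separable X
  have htight : IsTightMeasureSet {((ρ : ProbabilityMeasure (X × X)) : Measure (X × X)) |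
      ρ ∈ range π} := by
    refine IsTightMeasureSet.prodMk
      ((isTightMeasureSet_singleton (μ := ν)).subset ?_)
      ((isTightMeasureSet_singleton (μ := μ)).subset ?_)
    · rintro _ ⟨_, ⟨_, ⟨n, rfl⟩, rfl⟩, rfl⟩
      exact h1 n
    · rintro _ ⟨_, ⟨_, ⟨n, rfl⟩, rfl⟩, rfl⟩
      exact h2 n
  have hcomp := isCompact_closure_of_isTightMeasureSet htight
  obtain ⟨π₀, -, hπ₀⟩ := hcomp.ultrafilter_le_nhds' ((hyperfilter ℕ).map π)
    (by
      rw [Ultrafilter.mem_map]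
      exact Filter.univ_mem' fun n => subset_closure (mem_range_self n))
  have hlim : Tendsto π (hyperfilter ℕ) (𝓝 π₀) := hπ₀
  have hmarg : ∀ (ρ : Measure X) [IsProbabilityMeasure ρ] (p : X × X → X) (_ : Continuous p),
      (∀ n, (π n : Measure (X × X)).map p = ρ) → (π₀ : Measure (X × X)).map p = ρ := by
    intro ρ hρ p hp h
    have h3 := ProbabilityMeasure.tendsto_map_of_tendsto_of_continuous π π₀ hlim hp
    have h4 : ∀ n, (π n).map hp.measurable.aemeasurable =
        (⟨ρ, hρ⟩ : ProbabilityMeasure X) := fun n => Subtype.ext (h n)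
    simp only [h4] at h3
    have h5 : π₀.map hp.measurable.aemeasurable = (⟨ρ, hρ⟩ : ProbabilityMeasure X) :=
      tendsto_nhds_unique h3 tendsto_const_nhds
    exact congrArg Subtype.val h5
  exact ⟨π₀, hmarg ν _ continuous_fst h1, hmarg μ _ continuous_snd h2, hlim⟩

namespace IsYoung

variable {α : ℝ → ℝ}

lemma continuous (hα : IsYoung α) : Continuous α := hα.convex.locallyLipschitz.continuous

lemma truncation_nonneg_slope (hα : IsYoung α) (n : ℕ) : 0 ≤ α (n + 1) - α n :=
  sub_nonneg.2 (hα.mono.monotoneOn (mem_Ici.2 (by positivity)) (mem_Ici.2 (by positivity))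
    (by linarith))

/-- The truncation `t ↦ α (min t n)` is Lipschitz on `[0,∞)`. -/
lemma truncation_le_add (hα : IsYoung α) (n : ℕ) {s t : ℝ} (hs : 0 ≤ s) (ht : 0 ≤ t) {r : ℝ}
    (hr : 0 ≤ r) (h : t ≤ s + r) :
    α (min t n) ≤ α (min s n) + (α (n + 1) - α n) * r := by
  have hslope := hα.truncation_nonneg_slope n
  rcases le_or_gt (min t (n : ℝ)) (min s n) with hle | hlt
  · have := hα.mono.monotoneOn (mem_Ici.2 (le_min ht n.cast_nonneg))
      (mem_Ici.2 (le_min hs n.cast_nonneg)) hle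
    nlinarith [mul_nonneg hslope hr]
  · have h1 : (α (min t n) - α (min s n)) / (min t n - min s n) ≤ α (n + 1) - α n := by
      have hfar := hα.convex.secant_mono (a := (n : ℝ) + 1) (mem_univ _) (mem_univ (min s (n : ℝ)))
        (mem_univ (n : ℝ)) (by linarith [min_le_right s (n : ℝ)]) (by linarith)
        (min_le_right _ _)
      have hnear := hα.convex.secant_mono_aux2 (mem_univ (min s (n : ℝ)))
        (mem_univ ((n : ℝ) + 1)) hlt (by linarith [min_le_right t (n : ℝ)])
      have e1 : (α (n : ℝ) - α ((n : ℝ) + 1)) / ((n : ℝ) - ((n : ℝ) + 1)) = α (n + 1) - α n := by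
        ring
      have e2 : (α (min s (n : ℝ)) - α ((n : ℝ) + 1)) / (min s (n : ℝ) - ((n : ℝ) + 1)) =
          (α ((n : ℝ) + 1) - α (min s (n : ℝ))) / ((n : ℝ) + 1 - min s (n : ℝ)) := by
        rw [← neg_sub, ← neg_sub ((n : ℝ) + 1), neg_div_neg_eq]
      rw [e1, e2] at hfar
      exact hnear.trans hfar
    rw [div_le_iff₀ (by linarith)] at h1
    have h2 : min t (n : ℝ) - min s n ≤ r := by
      rcases le_total s (n : ℝ) with hsn | hsn
      · rw [min_eq_left hsn]; linarith [min_le_left t (n : ℝ)]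
      · rw [min_eq_right hsn]; linarith [min_le_right t (n : ℝ)]
    nlinarith [mul_le_mul_of_nonneg_left h2 hslope]

lemma truncation_dist_le (hα : IsYoung α) {X : Type*} [MetricSpace X] (n : ℕ) (x x' y y' : X) :
    α (min (dist x y) n) ≤ α (min (dist x' y') n)
      + min ((α (n + 1) - α n) * dist x x') (α n) + min ((α (n + 1) - α n) * dist y y') (α n) := by
  have hslope := hα.truncation_nonneg_slope n
  have htri : dist x y ≤ dist x' y' + (dist x x' + dist y y') := by
    linarith [dist_triangle4 x x' y' y, dist_comm y y']
  have h1 := hα.truncation_le_add n (dist_nonneg (x := x') (y := y'))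
    (dist_nonneg (x := x) (y := y)) (by positivity) htri
  have h2 : α (min (dist x y) n) ≤ α n :=
    hα.mono.monotoneOn (mem_Ici.2 (le_min dist_nonneg n.cast_nonneg)) (mem_Ici.2 n.cast_nonneg)
      (min_le_right _ _)
  have h3 := hα.nonneg (min (dist x' y') n)
  have h4 := hα.nonneg n
  have h5 := mul_nonneg hslope (dist_nonneg (x := x) (y := x'))
  have h6 := mul_nonneg hslope (dist_nonneg (x := y) (y := y'))
  rw [mul_add] at h1
  rcases min_cases ((α (n + 1) - α n) * dist x x') (α n) with h | h <;>
    rcases min_cases ((α (n + 1) - α n) * dist y y') (α n) with h' | h' <;>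
    rw [h.1, h'.1] <;> linarith

end IsYoung

/-- The hard half of Kantorovich duality for the cost `α (dist x y)`. -/
lemma transportCost_le_of_forall_dual {X : Type*} [MetricSpace X] [CompleteSpace X]
    [TopologicalSpace.SeparableSpace X] [MeasurableSpace X] [BorelSpace X]
    {α : ℝ → ℝ} (hα : IsYoung α)
    (ν μ : Measure X) [IsProbabilityMeasure ν] [IsProbabilityMeasure μ] {K : ℝ}
    (hK : ∀ f g : X → ℝ, Continuous f → IsBoundedFun f → Continuous g → IsBoundedFun g →
      (∀ x y, g x - f y ≤ α (dist x y)) → ∫ x, g x ∂ν - ∫ y, f y ∂μ ≤ K) :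
    transportCost α ν μ ≤ ENNReal.ofReal K := by
  have := UniformSpace.secondCountable_of_separable X
  have hmono : ∀ {s t : ℝ}, 0 ≤ s → s ≤ t → α s ≤ α t := fun hs hst =>
    hα.mono.monotoneOn (mem_Ici.2 hs) (mem_Ici.2 (hs.trans hst)) hst
  have hex : ∀ n : ℕ, ∃ π : Measure (X × X), π.map Prod.fst = ν ∧ π.map Prod.snd = μ ∧
      ∫⁻ z, ENNReal.ofReal (α (min (dist z.1 z.2) n)) ∂π ≤
        ENNReal.ofReal (K + 1 / ((n : ℝ) + 1)) := by
    intro n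
    refine exists_coupling_lintegral_le_of_lipschitz ν μ (c := fun x y => α (min (dist x y) n))
      (hα.truncation_nonneg_slope n) (hα.nonneg n) (fun x y => hα.nonneg _)
      (hα.truncation_dist_le n) (fun f g hf hfb hg hgb hfg => hK f g hf hfb hg hgb fun x y => ?_)
      (by positivity)
    exact (hfg x y).trans (hmono (le_min dist_nonneg n.cast_nonneg) (min_le_left _ _))
  choose π h1 h2 h3 using hex
  obtain ⟨π₀, hπ1, hπ2, hlim⟩ := exists_coupling_tendsto ν μ
    (fun n => ⟨π n, isProbabilityMeasure_of_map_fst (h1 n)⟩) h1 h2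
  have hbound : ∀ m : ℕ, ∫⁻ z, ENNReal.ofReal (α (min (dist z.1 z.2) m)) ∂(π₀ : Measure (X × X))
      ≤ ENNReal.ofReal K := by
    intro m
    have hcont : Continuous fun z : X × X => (α (min (dist z.1 z.2) m)).toNNReal :=
      continuous_real_toNNReal.comp (hα.continuous.comp (by fun_prop))
    let F : BoundedContinuousFunction (X × X) ℝ≥0 :=
      BoundedContinuousFunction.mkOfBound ⟨_, hcont⟩ (α m) (by
        intro z w
        have hle : ∀ z : X × X, α (min (dist z.1 z.2) m) ≤ α m := fun z =>
          hmono (le_min dist_nonneg m.cast_nonneg) (min_le_right _ _)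
        have hz := hα.nonneg (min (dist z.1 z.2) m)
        have hw := hα.nonneg (min (dist w.1 w.2) m)
        simp only [ContinuousMap.coe_mk, NNReal.dist_eq, Real.coe_toNNReal _ hz,
          Real.coe_toNNReal _ hw]
        rw [abs_le]
        constructor <;> linarith [hle z, hle w])
    have hF := (ProbabilityMeasure.tendsto_iff_forall_lintegral_tendsto.1 hlim) F
    have hK' : Tendsto (fun n : ℕ => ENNReal.ofReal (K + 1 / ((n : ℝ) + 1))) (hyperfilter ℕ)
        (𝓝 (ENNReal.ofReal K)) := by
      refine Tendsto.mono_left ?_ Nat.hyperfilter_le_atTop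
      refine (ENNReal.continuous_ofReal.tendsto K).comp ?_
      simpa using (tendsto_const_nhds (x := K)).add tendsto_one_div_add_atTop_nhds_zero_nat
    refine le_of_tendsto_of_tendsto hF hK' ?_
    filter_upwards [Nat.hyperfilter_le_atTop (eventually_ge_atTop m)] with n hn
    refine le_trans (lintegral_mono fun z => ?_) (h3 n)
    refine ENNReal.ofReal_le_ofReal (hmono (le_min dist_nonneg m.cast_nonneg) ?_)
    gcongr
  have hle : transportCost α ν μ ≤
      ∫⁻ z, ENNReal.ofReal (α (dist z.1 z.2)) ∂(π₀ : Measure (X × X)) :=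
    sInf_le ⟨π₀, hπ1, hπ2, rfl⟩
  refine hle.trans ?_
  have hsup : ∀ z : X × X, ENNReal.ofReal (α (dist z.1 z.2)) =
      ⨆ m : ℕ, ENNReal.ofReal (α (min (dist z.1 z.2) m)) := by
    intro z
    refine le_antisymm ?_ (iSup_le fun m => ENNReal.ofReal_le_ofReal
      (hmono (le_min dist_nonneg m.cast_nonneg) (min_le_left _ _)))
    obtain ⟨m, hm⟩ := exists_nat_ge (dist z.1 z.2)
    refine le_iSup_of_le m ?_
    rw [min_eq_left hm]
  simp only [hsup]
  rw [lintegral_iSup]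
  · exact iSup_le hbound
  · intro m
    exact (hα.continuous.comp (by fun_prop)).measurable.ennreal_ofReal
  · intro m n hmn z
    refine ENNReal.ofReal_le_ofReal (hmono (le_min dist_nonneg m.cast_nonneg) ?_)
    gcongr

section InfConvolution

variable {X : Type*} [MetricSpace X] {α : ℝ → ℝ} {f : X → ℝ}

lemma bddBelow_range_add_cost (hα : IsYoung α) (hb : IsBoundedFun f) (x : X) :
    BddBelow (range fun y => f y + 1 * α (dist x y)) := by
  obtain ⟨M, hM⟩ := hb
  refine ⟨-M, ?_⟩
  rintro _ ⟨y, rfl⟩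
  have h1 := (abs_le.1 (hM y)).1
  have h2 := hα.nonneg (dist x y)
  simp only
  linarith

lemma QInf_le (hα : IsYoung α) (hb : IsBoundedFun f) (x y : X) :
    QInf α 1 f x ≤ f y + α (dist x y) := by
  have := ciInf_le (bddBelow_range_add_cost hα hb x) y
  rwa [one_mul] at this

lemma isBoundedFun_QInf (hα : IsYoung α) (hb : IsBoundedFun f) : IsBoundedFun (QInf α 1 f) := by
  have hle := fun x => QInf_le hα hb x x
  obtain ⟨M, hM⟩ := hb
  refine ⟨M, fun x => abs_le.2 ⟨?_, ?_⟩⟩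
  · have : Nonempty X := ⟨x⟩
    refine le_ciInf fun y => ?_
    linarith [(abs_le.1 (hM y)).1, hα.nonneg (dist x y)]
  · have := hle x
    rw [dist_self, hα.zero, add_zero] at this
    exact this.trans (abs_le.1 (hM x)).2

lemma measurable_QInf [MeasurableSpace X] [BorelSpace X] (hα : IsYoung α) (hb : IsBoundedFun f) :
    Measurable (QInf α 1 f) := by
  refine UpperSemicontinuous.measurable (upperSemicontinuous_ciInf
    (bddBelow_range_add_cost hα hb) fun y => Continuous.upperSemicontinuous ?_)
  exact continuous_const.add (continuous_const.mul (hα.continuous.comp (by fun_prop)))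

end InfConvolution

lemma integrable_exp_of_isBoundedFun {Y : Type*} [MeasurableSpace Y] {h : Y → ℝ}
    (hb : IsBoundedFun h) (hm : Measurable h) (ρ : Measure Y) [IsFiniteMeasure ρ] :
    Integrable (fun x => Real.exp (h x)) ρ := by
  obtain ⟨M, hM⟩ := hb
  refine IsBoundedFun.integrable ⟨Real.exp M, fun x => ?_⟩ hm.exp ρ
  rw [Real.abs_exp]
  exact Real.exp_le_exp.2 (abs_le.1 (hM x)).2

lemma IsBoundedFun.const_mul {Y : Type*} {h : Y → ℝ} (hb : IsBoundedFun h) (c : ℝ) :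
    IsBoundedFun fun x => c * h x := by
  obtain ⟨M, hM⟩ := hb
  refine ⟨|c| * M, fun x => ?_⟩
  rw [abs_mul]
  exact mul_le_mul_of_nonneg_left (hM x) (abs_nonneg c)

lemma integral_llr_nonneg {Y : Type*} [MeasurableSpace Y] {ν μ : Measure Y}
    [IsProbabilityMeasure ν] [IsProbabilityMeasure μ] (hac : ν ≪ μ)
    (hint : Integrable (llr ν μ) ν) : 0 ≤ ∫ x, llr ν μ x ∂ν := by
  have := InformationTheory.integral_llr_add_sub_measure_univ_nonneg hac hint
  simpa using this

/-- The Gibbs variational inequality for bounded functions. -/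
lemma integral_le_integral_llr_add_log {Y : Type*} [MeasurableSpace Y] {ν μ : Measure Y}
    [IsProbabilityMeasure ν] [IsProbabilityMeasure μ] (hac : ν ≪ μ)
    (hint : Integrable (llr ν μ) ν) {h : Y → ℝ} (hb : IsBoundedFun h) (hm : Measurable h) :
    ∫ x, h x ∂ν ≤ ∫ x, llr ν μ x ∂ν + Real.log (∫ x, Real.exp (h x) ∂μ) := by
  have hexp := integrable_exp_of_isBoundedFun hb hm μ
  have hi := hb.integrable hm ν
  have : IsProbabilityMeasure (μ.tilted h) := isProbabilityMeasure_tilted hexp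
  have h1 := integral_llr_nonneg (hac.trans (absolutelyContinuous_tilted hexp))
    (integrable_llr_tilted_right hac hi hint hexp)
  rw [integral_llr_tilted_right hac hi hexp hint] at h1
  linarith

/-- Equality in the Gibbs variational inequality at the tilted measure. -/
lemma relEnt_tilted {X : Type*} [MetricSpace X] [MeasurableSpace X] {μ : Measure X}
    [IsProbabilityMeasure μ] {h : X → ℝ} (hb : IsBoundedFun h) (hm : Measurable h) :
    0 ≤ ∫ x, h x ∂(μ.tilted h) - Real.log (∫ x, Real.exp (h x) ∂μ) ∧
    relEnt (μ.tilted h) μ =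
      ENNReal.ofReal (∫ x, h x ∂(μ.tilted h) - Real.log (∫ x, Real.exp (h x) ∂μ)) := by
  have hexp := integrable_exp_of_isBoundedFun hb hm μ
  have : IsProbabilityMeasure (μ.tilted h) := isProbabilityMeasure_tilted hexp
  have hac : μ.tilted h ≪ μ := tilted_absolutelyContinuous μ h
  have hllr : llr (μ.tilted h) μ =ᵐ[μ.tilted h]
      fun x => h x - Real.log (∫ z, Real.exp (h z) ∂μ) := by
    refine hac.ae_le ?_
    filter_upwards [llr_tilted_left Measure.AbsolutelyContinuous.rfl hexp hm.aemeasurable,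
      llr_self μ] with x hx hx'
    rw [hx, hx']
    simp
  have hi := hb.integrable hm (μ.tilted h)
  have hint : Integrable (llr (μ.tilted h) μ) (μ.tilted h) :=
    (integrable_congr hllr).2 (hi.sub (integrable_const _))
  have heq : ∫ x, llr (μ.tilted h) μ x ∂(μ.tilted h) =
      ∫ x, h x ∂(μ.tilted h) - Real.log (∫ x, Real.exp (h x) ∂μ) := by
    rw [integral_congr_ae hllr, integral_sub hi (integrable_const _)]
    simp
  refine ⟨heq ▸ integral_llr_nonneg hac hint, ?_⟩
  rw [← heq]
  exact if_pos ⟨hac, hint⟩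

/-- The easy half of Kantorovich duality. -/
lemma ofReal_integral_sub_le_transportCost {X : Type*} [MetricSpace X] [MeasurableSpace X]
    {α : ℝ → ℝ} {ν μ : Measure X} [IsProbabilityMeasure ν] [IsProbabilityMeasure μ]
    {f g : X → ℝ} (hf : Measurable f) (hfb : IsBoundedFun f) (hg : Measurable g)
    (hgb : IsBoundedFun g) (h : ∀ x y, g x - f y ≤ α (dist x y)) :
    ENNReal.ofReal (∫ x, g x ∂ν - ∫ y, f y ∂μ) ≤ transportCost α ν μ := by
  refine le_sInf ?_
  rintro _ ⟨π, h1, h2, rfl⟩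
  have : IsProbabilityMeasure π := isProbabilityMeasure_of_map_fst h1
  have hgi : Integrable (fun z : X × X => g z.1) π :=
    Integrable.comp_measurable (h1 ▸ hgb.integrable hg ν) measurable_fst
  have hfi : Integrable (fun z : X × X => f z.2) π :=
    Integrable.comp_measurable (h2 ▸ hfb.integrable hf μ) measurable_snd
  have e1 : ∫ x, g x ∂ν = ∫ z, g z.1 ∂π := by
    rw [← h1, integral_map measurable_fst.aemeasurable hg.aestronglyMeasurable]
  have e2 : ∫ y, f y ∂μ = ∫ z, f z.2 ∂π := by
    rw [← h2, integral_map measurable_snd.aemeasurable hf.aestronglyMeasurable]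
  have hint : Integrable (fun z : X × X => g z.1 - f z.2) π := hgi.sub hfi
  rw [e1, e2, ← integral_sub hgi hfi]
  calc ENNReal.ofReal (∫ z, (g z.1 - f z.2) ∂π)
      ≤ ENNReal.ofReal (∫ z, max (g z.1 - f z.2) 0 ∂π) :=
        ENNReal.ofReal_le_ofReal (integral_mono hint hint.pos_part fun z => le_max_left _ _)
    _ = ∫⁻ z, ENNReal.ofReal (max (g z.1 - f z.2) 0) ∂π :=
        ofReal_integral_eq_lintegral_ofReal hint.pos_part (ae_of_all _ fun z => le_max_right _ _)
    _ ≤ ∫⁻ z, ENNReal.ofReal (α (dist z.1 z.2)) ∂π := by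
        refine lintegral_mono fun z => ?_
        rw [ENNReal.ofReal_max, ENNReal.ofReal_zero, max_eq_left zero_le]
        exact ENNReal.ofReal_le_ofReal (h _ _)

theorem bobkov_goetze_dual
    {X : Type*} [MetricSpace X] [CompleteSpace X] [TopologicalSpace.SeparableSpace X]
    [MeasurableSpace X] [BorelSpace X]
    (α : ℝ → ℝ) (hα : IsYoung α)
    (μ : Measure X) [IsProbabilityMeasure μ] (c : ℝ) (hc : 0 < c) :
    TransportEntropy μ α (1 / c) ↔
      ∀ f : X → ℝ, Continuous f → IsBoundedFun f →
        ∫ x, Real.exp (c * QInf α 1 f x) ∂μ ≤ Real.exp (c * ∫ x, f x ∂μ) := by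
  constructor
  · intro hT f hf hfb
    have hQb := isBoundedFun_QInf hα hfb
    have hQm := measurable_QInf hα hfb
    have hb := hQb.const_mul c
    have hm : Measurable fun x => c * QInf α 1 f x := hQm.const_mul c
    have hexp := integrable_exp_of_isBoundedFun hb hm μ
    have hν : IsProbabilityMeasure (μ.tilted fun x => c * QInf α 1 f x) :=
      isProbabilityMeasure_tilted hexp
    obtain ⟨hnonneg, hrel⟩ := relEnt_tilted (μ := μ) hb hm
    have h1 := (ofReal_integral_sub_le_transportCost (α := α) hf.measurable hfb hQm hQb
      fun x y => by linarith [QInf_le hα hfb x y]).trans (hT _ hν)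
    rw [hrel, ← ENNReal.ofReal_mul (by positivity),
      ENNReal.ofReal_le_ofReal_iff (mul_nonneg (by positivity) hnonneg), one_div,
      inv_mul_eq_div, le_div_iff₀ hc, integral_const_mul] at h1
    have hpos : 0 < ∫ x, Real.exp (c * QInf α 1 f x) ∂μ := integral_exp_pos hexp
    rw [← Real.log_le_iff_le_exp hpos]
    linarith
  · intro hQ ν hν
    by_cases hent : ν ≪ μ ∧ Integrable (fun x => Real.log (ν.rnDeriv μ x).toReal) ν
    · rw [relEnt, if_pos hent, ← ENNReal.ofReal_mul (by positivity)]
      refine transportCost_le_of_forall_dual hα ν μ fun f g hf hfb hg hgb hfg => ?_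
      have hQb := isBoundedFun_QInf hα hfb
      have hQm := measurable_QInf hα hfb
      have hb := hQb.const_mul c
      have hm : Measurable fun x => c * QInf α 1 f x := hQm.const_mul c
      have hexp := integrable_exp_of_isBoundedFun hb hm μ
      have h1 := integral_le_integral_llr_add_log hent.1 hent.2 hb hm
      have h2 := (Real.log_le_iff_le_exp (integral_exp_pos hexp)).2 (hQ f hf hfb)
      have h3 : ∫ x, g x ∂ν ≤ ∫ x, QInf α 1 f x ∂ν := by
        refine integral_mono (hgb.integrable hg.measurable ν) (hQb.integrable hQm ν) fun x => ?_
        have : Nonempty X := ⟨x⟩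
        exact le_ciInf fun y => by linarith [hfg x y]
      rw [integral_const_mul] at h1
      have h4 := mul_le_mul_of_nonneg_left h3 hc.le
      change _ ≤ 1 / c * ∫ x, llr ν μ x ∂ν
      rw [one_div, inv_mul_eq_div, le_div_iff₀ hc]
      linarith
    · rw [relEnt, if_neg hent, ENNReal.mul_top (by simpa using hc)]
      exact le_top
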